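/- There is no BH(15,3), there is no BH(33,3), and there is no BH(15,5). -/

import Mathlib

/-- A Butson Hadamard matrix `BH(n,k)`: an `n × n` complex matrix whose entries
are `k`-th roots of unity with `H * Hᴴ = n • 1`. -/
def IsBH (n k : ℕ) (H : Matrix (Fin n) (Fin n) ℂ) : Prop :=
  (∀ i j, H i j ^ k = 1) ∧ H * H.conjTranspose = (n : ℂ) • 1

open ComplexConjugate in
/-- In the ring generated by the `k`-th roots of unity, the power map `x ↦ x ^ q` agrees with
complex conjugation modulo `p`, whenever `q` is a power of `p` and `q ≡ -1` modulo `k`. -/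
theorem exists_pow_eq_conj_add_mul {p f k : ℕ} [Fact p.Prime] (hk : k ∣ p ^ f + 1) {x : ℂ}
    (hx : x ∈ Algebra.adjoin ℤ {z : ℂ | z ^ k = 1}) :
    ∃ y ∈ Algebra.adjoin ℤ {z : ℂ | z ^ k = 1}, x ^ p ^ f = conj x + p * y := by
  have hk0 : k ≠ 0 := by
    rintro rfl
    simp at hk
  induction hx using Algebra.adjoin_induction with
  | mem z hz =>
    refine ⟨0, zero_mem _, ?_⟩
    have hz' : z ^ k = 1 := hz
    have hnorm : z * conj z = 1 := by
      rw [Complex.mul_conj', Complex.norm_eq_one_of_pow_eq_one hz' hk0]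
      simp
    obtain ⟨c, hc⟩ := hk
    have hpow : z ^ p ^ f * z = 1 := by rw [← pow_succ, hc, pow_mul, hz', one_pow]
    linear_combination conj z * hpow - z ^ p ^ f * hnorm
  | algebraMap n =>
    have hdvd : (p : ℤ) ∣ n ^ p ^ f - n := by
      rw [← ZMod.intCast_zmod_eq_zero_iff_dvd]
      push_cast
      rw [ZMod.pow_card_pow, sub_self]
    obtain ⟨c, hc⟩ := hdvd
    refine ⟨c, intCast_mem _ c, ?_⟩
    have hc' : (n : ℂ) ^ p ^ f - n = p * c := by exact_mod_cast hc
    simp only [eq_intCast, map_intCast]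
    linear_combination hc'
  | add x y hx hy ihx ihy =>
    obtain ⟨a, ha, hxa⟩ := ihx
    obtain ⟨b, hb, hyb⟩ := ihy
    obtain ⟨r, hr⟩ := exists_add_pow_prime_pow_eq (Fact.out : p.Prime)
      (⟨x, hx⟩ : Algebra.adjoin ℤ {z : ℂ | z ^ k = 1}) ⟨y, hy⟩ f
    have hr' : (x + y) ^ p ^ f = x ^ p ^ f + y ^ p ^ f + p * (x * y * r) := by
      simpa [mul_assoc] using congrArg Subtype.val hr
    refine ⟨a + b + x * y * r,
      add_mem (add_mem ha hb) (mul_mem (mul_mem hx hy) r.2), ?_⟩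
    rw [hr', hxa, hyb, map_add]
    ring
  | mul x y hx hy ihx ihy =>
    obtain ⟨a, ha, hxa⟩ := ihx
    obtain ⟨b, hb, hyb⟩ := ihy
    refine ⟨x ^ p ^ f * b + a * (y ^ p ^ f - p * b), ?_, ?_⟩
    · exact add_mem (mul_mem (pow_mem hx _) hb)
        (mul_mem ha (sub_mem (pow_mem hy _) (mul_mem (natCast_mem _ p) hb)))
    · rw [mul_pow, map_mul, hxa, hyb]
      ring

open ComplexConjugate in
theorem conj_mem_adjoin_roots {k : ℕ} {x : ℂ}
    (hx : x ∈ Algebra.adjoin ℤ {z : ℂ | z ^ k = 1}) :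
    conj x ∈ Algebra.adjoin ℤ {z : ℂ | z ^ k = 1} := by
  induction hx using Algebra.adjoin_induction with
  | mem z hz =>
    refine Algebra.subset_adjoin ?_
    have hz' : z ^ k = 1 := hz
    simp [← map_pow, hz']
  | algebraMap n => simp
  | add x y _ _ ihx ihy => simpa using add_mem ihx ihy
  | mul x y _ _ ihx ihy => simpa using mul_mem ihx ihy

open ComplexConjugate in
/-- If `p` is self-conjugate modulo `k` and divides `x * conj x`, then it divides `x`. -/
theorem exists_eq_mul_of_mul_conj_eq {p f k : ℕ} [Fact p.Prime] (hf : f ≠ 0)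
    (hk : k ∣ p ^ f + 1) {x w : ℂ} (hx : x ∈ Algebra.adjoin ℤ {z : ℂ | z ^ k = 1})
    (hw : w ∈ Algebra.adjoin ℤ {z : ℂ | z ^ k = 1}) (h : x * conj x = p * w) :
    ∃ y ∈ Algebra.adjoin ℤ {z : ℂ | z ^ k = 1}, x = p * y := by
  obtain ⟨a, ha, hxa⟩ := exists_pow_eq_conj_add_mul hk hx
  obtain ⟨b, hb, hxb⟩ := exists_pow_eq_conj_add_mul hk (conj_mem_adjoin_roots hx)
  obtain ⟨c, hc, hxc⟩ := exists_pow_eq_conj_add_mul hk (pow_mem hx (p ^ f))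
  rw [Complex.conj_conj] at hxb
  rw [map_pow, hxb] at hxc
  have hq : 2 ≤ p ^ f :=
    (Fact.out : p.Prime).two_le.trans (Nat.le_self_pow hf p)
  obtain ⟨e, he⟩ := Nat.exists_eq_add_of_le (show p ^ f + 1 ≤ p ^ f * p ^ f by nlinarith)
  have hsplit : (x ^ p ^ f) ^ p ^ f = x ^ p ^ f * x * x ^ e := by
    rw [← pow_mul, he, pow_add, pow_succ]
  refine ⟨(w + a * x) * x ^ e - b - c, ?_, ?_⟩
  · exact sub_mem (sub_mem (mul_mem (add_mem hw (mul_mem ha hx)) (pow_mem hx _)) hb) hc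
  · rw [hxc] at hsplit
    linear_combination hsplit + x * x ^ e * hxa + x ^ e * h

theorem isIntegral_of_mem_adjoin_roots {k : ℕ} (hk : k ≠ 0) {x : ℂ}
    (hx : x ∈ Algebra.adjoin ℤ {z : ℂ | z ^ k = 1}) : IsIntegral ℤ x := by
  have hle : Algebra.adjoin ℤ {z : ℂ | z ^ k = 1} ≤ integralClosure ℤ ℂ :=
    Algebra.adjoin_le fun z hz => by
      have hz' : z ^ k = 1 := hz
      exact IsIntegral.of_pow (Nat.pos_of_ne_zero hk) (hz' ▸ isIntegral_one)
  exact hle hx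

theorem natCast_dvd_of_eq_mul_isIntegral {p u : ℕ} (hp : p ≠ 0) {w : ℂ} (hw : IsIntegral ℤ w)
    (h : (u : ℂ) = p * w) : p ∣ u := by
  have hp' : (p : ℂ) ≠ 0 := Nat.cast_ne_zero.mpr hp
  have hwq : w = algebraMap ℚ ℂ (u / p) := by
    simp only [eq_ratCast]
    push_cast
    rw [h]
    field_simp
  rw [hwq, isIntegral_algebraMap_iff (algebraMap ℚ ℂ).injective,
    IsIntegrallyClosed.isIntegral_iff] at hw
  obtain ⟨c, hc⟩ := hw
  have hpq : (p : ℚ) ≠ 0 := Nat.cast_ne_zero.mpr hp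
  rw [eq_div_iff hpq, eq_intCast] at hc
  have hcu : c * p = (u : ℤ) := by exact_mod_cast hc
  exact_mod_cast (Dvd.intro_left c hcu : (p : ℤ) ∣ u)

open ComplexConjugate in
/-- A self-conjugate prime divides a norm `x * conj x` to an even power. -/
theorem dvd_of_mul_conj_eq_odd_pow_mul {p f k : ℕ} [Fact p.Prime] (hf : f ≠ 0)
    (hk : k ∣ p ^ f + 1) {u : ℕ} (m : ℕ) {x : ℂ}
    (hx : x ∈ Algebra.adjoin ℤ {z : ℂ | z ^ k = 1})
    (h : x * conj x = (p : ℂ) ^ (2 * m + 1) * u) : p ∣ u := by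
  have hp0 : p ≠ 0 := (Fact.out : p.Prime).ne_zero
  have hp : (p : ℂ) ≠ 0 := Nat.cast_ne_zero.mpr hp0
  have hk0 : k ≠ 0 := by
    rintro rfl
    simp at hk
  induction m generalizing x with
  | zero =>
    obtain ⟨y, hy, rfl⟩ := exists_eq_mul_of_mul_conj_eq hf hk hx (natCast_mem _ u)
      (by simpa using h)
    refine natCast_dvd_of_eq_mul_isIntegral hp0
      (isIntegral_of_mem_adjoin_roots hk0 (mul_mem hy (conj_mem_adjoin_roots hy))) ?_
    rw [map_mul, Complex.conj_natCast] at h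
    apply mul_left_cancel₀ hp
    linear_combination -h
  | succ m ih =>
    obtain ⟨y, hy, rfl⟩ := exists_eq_mul_of_mul_conj_eq (w := (p : ℂ) ^ (2 * m + 2) * u) hf hk hx
      (mul_mem (pow_mem (natCast_mem _ p) _) (natCast_mem _ u)) (by rw [h]; ring)
    refine ih hy ?_
    rw [map_mul, Complex.conj_natCast] at h
    apply mul_left_cancel₀ (pow_ne_zero 2 hp)
    linear_combination h

/-- There is no `BH(n,k)` with `n` odd if some prime `p` divides `n` to an odd power and is
self-conjugate modulo `k`. -/
theorem not_isBH_of_self_conjugate {n k p f a v : ℕ} [Fact p.Prime] (hf : f ≠ 0)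
    (hk : k ∣ p ^ f + 1) (hn : Odd n) (ha : Odd a) (hnv : n = p ^ a * v) (hv : ¬ p ∣ v)
    (H : Matrix (Fin n) (Fin n) ℂ) : ¬ IsBH n k H := by
  rintro ⟨hroot, hH⟩
  have hmem : H.det ∈ Algebra.adjoin ℤ {z : ℂ | z ^ k = 1} := by
    rw [Matrix.det_apply']
    exact sum_mem fun σ _ => mul_mem (intCast_mem _ _)
      (prod_mem fun i _ => Algebra.subset_adjoin (hroot _ _))
  have hdet := congrArg Matrix.det hH
  rw [Matrix.det_mul, Matrix.det_conjTranspose, Matrix.det_smul, Matrix.det_one,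
    Fintype.card_fin, mul_one] at hdet
  obtain ⟨m, hm⟩ := ha.mul hn
  refine hv ((Fact.out : p.Prime).dvd_of_dvd_pow
    (dvd_of_mul_conj_eq_odd_pow_mul (u := v ^ n) hf hk m hmem ?_))
  have hnn : n ^ n = p ^ (2 * m + 1) * v ^ n := by
    rw [← hm, pow_mul, ← mul_pow, ← hnv]
  exact hdet.trans (by exact_mod_cast hnn)

/-- Remark 2.5: there is no `BH(15,3)`, no `BH(33,3)` and no `BH(15,5)`. -/
theorem no_BH_15_3_and_33_3_and_15_5 :
    (¬ ∃ H : Matrix (Fin 15) (Fin 15) ℂ, IsBH 15 3 H) ∧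
    (¬ ∃ H : Matrix (Fin 33) (Fin 33) ℂ, IsBH 33 3 H) ∧
    (¬ ∃ H : Matrix (Fin 15) (Fin 15) ℂ, IsBH 15 5 H) := by
  have : Fact (Nat.Prime 5) := ⟨by norm_num⟩
  have : Fact (Nat.Prime 11) := ⟨by norm_num⟩
  refine ⟨fun ⟨H, hH⟩ => ?_, fun ⟨H, hH⟩ => ?_, fun ⟨H, hH⟩ => ?_⟩
  · exact not_isBH_of_self_conjugate (p := 5) (f := 1) (a := 1) (v := 3) (by norm_num)
      (by norm_num) (by decide) (by decide) (by norm_num) (by norm_num) H hH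
  · exact not_isBH_of_self_conjugate (p := 11) (f := 1) (a := 1) (v := 3) (by norm_num)
      (by norm_num) (by decide) (by decide) (by norm_num) (by norm_num) H hH
  · exact not_isBH_of_self_conjugate (p := 3) (f := 2) (a := 1) (v := 5) (by norm_num)
      (by norm_num) (by decide) (by decide) (by norm_num) (by norm_num) H hH
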